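/- Let ε be a Rademacher random variable (P(ε = −1) = P(ε = 1) = 1/2), let ζ be a centered Gaussian random vector in ℝ^d with covariance matrix R independent of ε, let μ ∈ ℝ^d be a fixed vector, and set X = εμ + ζ. For any multiset A = {α₁,…,α_{2N}} of 2N indices with 1 ≤ α_i ≤ d, E[X_A] = ∑_{k=0}^{N} ∑_{S ⊆ A, |S| = 2k} μ_S · ∑_{σ∈Π(A∖S)} ∏_{pairs (i,j) of σ} E[ζ_{α_i} ζ_{α_j}], where the inner sum over S runs over all sub-multisets of A (i.e., subsets of the index positions) of cardinality 2k. -/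

import Mathlib

open MeasureTheory ProbabilityTheory Matrix Finset
open scoped Classical

/-- The centered `d`-variate Gaussian density with covariance matrix `R`:
`φ_R(x) = |2πR|^{-1/2} exp(-½ xᵀ R⁻¹ x)`. -/
noncomputable def gaussianPdf {d : ℕ} (R : Matrix (Fin d) (Fin d) ℝ) (x : Fin d → ℝ) : ℝ :=
  (Real.sqrt ((2 * Real.pi) ^ d * R.det))⁻¹ * Real.exp (-(x ⬝ᵥ (R⁻¹ *ᵥ x)) / 2)

/-- The centered Gaussian measure on `ℝ^d` with (positive definite) covariance matrix `R`. -/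
noncomputable def gaussianMeasure {d : ℕ} (R : Matrix (Fin d) (Fin d) ℝ) :
    Measure (Fin d → ℝ) :=
  volume.withDensity fun x => ENNReal.ofReal (gaussianPdf R x)

/-- Pairings of a finite set `B` of index positions, encoded as fixed-point-free (on `B`)
involutions of `Fin m` that fix the complement of `B` pointwise. -/
noncomputable def pairingsOn {m : ℕ} (B : Finset (Fin m)) : Finset (Equiv.Perm (Fin m)) :=
  Finset.univ.filter fun σ =>
    (∀ i, σ (σ i) = i) ∧ (∀ i ∈ B, σ i ≠ i ∧ σ i ∈ B) ∧ ∀ i ∉ B, σ i = i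

/-- The Isserlis pairing sum `∑_{σ∈Π(B)} ∏_{pairs (i,j) of σ} C (α i) (α j)` over the
set `B` of index positions, where `C i j` stands for the second moment `E[X_i X_j]`. -/
noncomputable def pairSum {d m : ℕ} (C : Fin d → Fin d → ℝ) (α : Fin m → Fin d)
    (B : Finset (Fin m)) : ℝ :=
  ∑ σ ∈ pairingsOn B, ∏ i ∈ B.filter (fun i => i < σ i), C (α i) (α (σ i))

lemma Matrix.PosDef.exists_pos_mul_sum_sq_le {ι : Type*} [Fintype ι]
    {S : Matrix ι ι ℝ} (hS : S.PosDef) :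
    ∃ c > 0, ∀ x : ι → ℝ, c * ∑ i, x i ^ 2 ≤ x ⬝ᵥ (S *ᵥ x) := by
  rcases isEmpty_or_nonempty ι with h | h
  · exact ⟨1, one_pos, fun x => by simp [dotProduct]⟩
  have hcont : Continuous fun x : EuclideanSpace ℝ ι => x.ofLp ⬝ᵥ (S *ᵥ x.ofLp) := by
    simp only [dotProduct, mulVec]
    fun_prop
  obtain ⟨y, hy, hmin⟩ := (isCompact_sphere (0 : EuclideanSpace ℝ ι) 1).exists_isMinOn
    (NormedSpace.sphere_nonempty.2 zero_le_one) hcont.continuousOn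
  have hy0 : y.ofLp ≠ 0 := by
    intro h0
    have : y = 0 := by ext i; simpa using congrFun h0 i
    simp [this] at hy
  refine ⟨_, by simpa using hS.dotProduct_mulVec_pos hy0, fun x => ?_⟩
  rcases eq_or_ne x 0 with rfl | hx
  · simp
  set z : EuclideanSpace ℝ ι := WithLp.toLp 2 x
  have hz : z ≠ 0 := by
    intro h0
    exact hx (by ext i; simpa [z] using congrArg (fun w : EuclideanSpace ℝ ι => w i) h0)
  have hz0 : ‖z‖ ≠ 0 := norm_ne_zero_iff.2 hz
  have hsum : ∑ i, x i ^ 2 = ‖z‖ ^ 2 := by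
    simp [EuclideanSpace.norm_sq_eq, z]
  have := hmin (show ‖z‖⁻¹ • z ∈ Metric.sphere 0 1 by simp [norm_smul, hz0])
  simp only [Set.mem_ofPred_eq, WithLp.ofLp_smul, mulVec_smul, dotProduct_smul, smul_dotProduct,
    smul_eq_mul] at this
  rw [hsum]
  calc _ ≤ ‖z‖⁻¹ * (‖z‖⁻¹ * (x ⬝ᵥ S *ᵥ x)) * ‖z‖ ^ 2 := by gcongr
    _ = _ := by field_simp

lemma integrable_prod_pow_mul_exp_neg_mul_sq {ι : Type*} [Fintype ι] {c : ℝ} (hc : 0 < c)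
    (n : ι → ℕ) :
    Integrable fun x : ι → ℝ => (∏ i, x i ^ n i) * Real.exp (-c * ∑ i, x i ^ 2) := by
  have h : ∀ i, Integrable fun t : ℝ => t ^ n i * Real.exp (-c * t ^ 2) := fun i => by
    simpa using integrable_rpow_mul_exp_neg_mul_sq hc (s := n i)
      (by linarith [(n i).cast_nonneg (α := ℝ)])
  refine (Integrable.fintype_prod h).congr (ae_of_all _ fun x => ?_)
  simp only
  rw [Finset.prod_mul_distrib, ← Real.exp_sum, Finset.mul_sum]

namespace MvPolynomial

lemma hasFDerivAt_eval {ι : Type*} [Fintype ι] (p : MvPolynomial ι ℝ) (x : ι → ℝ) :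
    HasFDerivAt (fun y => eval y p)
      (∑ i, eval x (pderiv i p) • ContinuousLinearMap.proj (R := ℝ) (φ := fun _ : ι => ℝ) i) x := by
  induction p using MvPolynomial.induction_on with
  | C a => simpa using hasFDerivAt_const a x
  | add p q hp hq =>
    simp only [map_add, add_smul, Finset.sum_add_distrib]
    exact hp.add hq
  | mul_X p i hp =>
    simp only [map_mul, eval_X]
    refine (hp.mul (hasFDerivAt_apply (𝕜 := ℝ) i x)).congr_fderiv ?_
    ext v
    simp [pderiv_X, Pi.single_apply, add_mul, Finset.sum_add_distrib, Finset.mul_sum]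
    simp [apply_ite (eval x), mul_assoc]

lemma fderiv_eval_single {ι : Type*} [Fintype ι] [DecidableEq ι] (p : MvPolynomial ι ℝ) (x : ι → ℝ) (j : ι) :
    fderiv ℝ (fun y => eval y p) x (Pi.single j 1) = eval x (pderiv j p) := by
  rw [(hasFDerivAt_eval p x).fderiv]
  simp [Pi.single_apply]

end MvPolynomial

/-- The exponent `-½ xᵀ R⁻¹ x` of the Gaussian density, as a polynomial in the coordinates. -/
noncomputable def gaussianExponent {d : ℕ} (R : Matrix (Fin d) (Fin d) ℝ) :
    MvPolynomial (Fin d) ℝ :=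
  ∑ i, ∑ j, MvPolynomial.C (-R⁻¹ i j / 2) * (MvPolynomial.X i * MvPolynomial.X j)

section Gaussian

open MvPolynomial

variable {d : ℕ} {R : Matrix (Fin d) (Fin d) ℝ}

lemma eval_gaussianExponent (R : Matrix (Fin d) (Fin d) ℝ) (x : Fin d → ℝ) :
    eval x (gaussianExponent R) = -(x ⬝ᵥ (R⁻¹ *ᵥ x)) / 2 := by
  simp only [gaussianExponent, map_sum, map_mul, eval_C, eval_X, dotProduct, mulVec,
    Finset.mul_sum, neg_div, Finset.sum_div, ← Finset.sum_neg_distrib]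
  exact Finset.sum_congr rfl fun i _ => Finset.sum_congr rfl fun j _ => by ring

lemma pderiv_gaussianExponent (hR : R.IsSymm) (j : Fin d) :
    pderiv j (gaussianExponent R) = -∑ k, C (R⁻¹ j k) * X k := by
  have hs : ∀ i, R⁻¹ i j = R⁻¹ j i := fun i => hR.inv.apply j i
  simp only [gaussianExponent, map_sum, pderiv_mul, pderiv_X, Pi.single_apply]
  simp [mul_add, Finset.sum_add_distrib, hs, ← Finset.sum_neg_distrib]
  rw [← Finset.sum_add_distrib]
  refine Finset.sum_congr rfl fun k _ => ?_
  have h2 : (C (-R⁻¹ j k / 2) : MvPolynomial (Fin d) ℝ) + C (-R⁻¹ j k / 2) = -C (R⁻¹ j k) := by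
    rw [← map_add, ← map_neg]
    congr 1
    ring
  rw [← add_mul, h2, neg_mul]

lemma gaussianPdf_eq (R : Matrix (Fin d) (Fin d) ℝ) (x : Fin d → ℝ) :
    gaussianPdf R x = (Real.sqrt ((2 * Real.pi) ^ d * R.det))⁻¹ *
      Real.exp (eval x (gaussianExponent R)) := by
  rw [eval_gaussianExponent, gaussianPdf]

lemma continuous_gaussianPdf (R : Matrix (Fin d) (Fin d) ℝ) : Continuous (gaussianPdf R) := by
  simp only [funext (gaussianPdf_eq R)]
  have := MvPolynomial.continuous_eval (gaussianExponent R)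
  fun_prop

lemma gaussianPdf_nonneg (R : Matrix (Fin d) (Fin d) ℝ) (x : Fin d → ℝ) :
    0 ≤ gaussianPdf R x := by
  unfold gaussianPdf; positivity

lemma hasFDerivAt_gaussianPdf (R : Matrix (Fin d) (Fin d) ℝ) (x : Fin d → ℝ) :
    HasFDerivAt (gaussianPdf R) (gaussianPdf R x • ∑ i, eval x (pderiv i (gaussianExponent R)) •
      ContinuousLinearMap.proj (R := ℝ) (φ := fun _ : Fin d => ℝ) i) x := by
  rw [funext (gaussianPdf_eq R)]
  simpa only [smul_smul] using ((hasFDerivAt_eval (gaussianExponent R) x).exp).const_mul _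

lemma fderiv_gaussianPdf_single (hR : R.IsSymm) (x : Fin d → ℝ) (j : Fin d) :
    fderiv ℝ (gaussianPdf R) x (Pi.single j 1) =
      -(eval x (∑ k, C (R⁻¹ j k) * X k) * gaussianPdf R x) := by
  have := pderiv_gaussianExponent hR j
  rw [(hasFDerivAt_gaussianPdf R x).fderiv]
  simp [Pi.single_apply, this, mul_comm]

lemma integrable_eval_mul_gaussianPdf (hR : R.PosDef) (p : MvPolynomial (Fin d) ℝ) :
    Integrable fun x => eval x p * gaussianPdf R x := by
  obtain ⟨c, hc, hle⟩ := hR.inv.exists_pos_mul_sum_sq_le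
  simp only [eval_eq', Finset.sum_mul]
  refine integrable_finsetSum _ fun n _ => ?_
  refine Integrable.mono' (((integrable_prod_pow_mul_exp_neg_mul_sq (half_pos hc) n).norm.const_mul
    (Real.sqrt ((2 * Real.pi) ^ d * R.det))⁻¹).const_mul |coeff n p|) ?_ (ae_of_all _ fun x => ?_)
  · have := continuous_gaussianPdf R
    exact Continuous.aestronglyMeasurable (by fun_prop)
  · rw [gaussianPdf, norm_mul, norm_mul, norm_mul, norm_mul, mul_assoc, Real.norm_eq_abs (coeff n p),
      Real.norm_of_nonneg (Real.exp_pos _).le, Real.norm_of_nonneg (Real.exp_pos _).le,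
      Real.norm_of_nonneg (inv_nonneg.2 (Real.sqrt_nonneg _)), mul_left_comm ‖∏ i, x i ^ n i‖]
    gcongr
    linarith [hle x]

/-- Integration by parts of a polynomial against the Gaussian density. -/
lemma integral_eval_mul_gaussianPdf_by_parts (hR : R.PosDef) (p : MvPolynomial (Fin d) ℝ)
    (j : Fin d) :
    ∫ x, eval x (p * ∑ k, C (R⁻¹ j k) * X k) * gaussianPdf R x =
      ∫ x, eval x (pderiv j p) * gaussianPdf R x := by
  have hS : R.IsSymm := by
    simpa [IsSymm, conjTranspose_eq_transpose_of_trivial] using hR.isHermitian.eq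
  have h := integral_mul_fderiv_eq_neg_fderiv_mul_of_integrable (𝕜 := ℝ) (μ := volume)
    (f := fun x => eval x p) (g := gaussianPdf R) (v := Pi.single j 1)
    (by simpa only [fderiv_eval_single] using integrable_eval_mul_gaussianPdf hR (pderiv j p))
    (by
      simp only [fderiv_gaussianPdf_single hS]
      refine (integrable_eval_mul_gaussianPdf hR (p * ∑ k, C (R⁻¹ j k) * X k)).neg.congr
        (ae_of_all _ fun x => ?_)
      simp [mul_assoc])
    (integrable_eval_mul_gaussianPdf hR p)
    (fun x _ => (hasFDerivAt_eval p x).differentiableAt)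
    (fun x _ => (hasFDerivAt_gaussianPdf R x).differentiableAt)
  simp only [fderiv_eval_single, fderiv_gaussianPdf_single hS, mul_neg, integral_neg, neg_inj] at h
  rw [← h]
  simp only [map_mul, mul_assoc]

lemma integrable_eval_gaussianMeasure (hR : R.PosDef) (p : MvPolynomial (Fin d) ℝ) :
    Integrable (fun x => eval x p) (gaussianMeasure R) := by
  rw [gaussianMeasure, integrable_withDensity_iff (by
    exact (continuous_gaussianPdf R).measurable.ennreal_ofReal) (by simp)]
  simpa [ENNReal.toReal_ofReal (gaussianPdf_nonneg R _)] using integrable_eval_mul_gaussianPdf hR p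

lemma integral_eval_gaussianMeasure (R : Matrix (Fin d) (Fin d) ℝ) (p : MvPolynomial (Fin d) ℝ) :
    ∫ x, eval x p ∂gaussianMeasure R = ∫ x, eval x p * gaussianPdf R x := by
  rw [gaussianMeasure, integral_withDensity_eq_integral_toReal_smul
    (continuous_gaussianPdf R).measurable.ennreal_ofReal (by simp)]
  simp [ENNReal.toReal_ofReal (gaussianPdf_nonneg R _), mul_comm]

/-- **Stein's identity** for a polynomial in the coordinates of a centered Gaussian vector. -/
lemma integral_eval_X_mul_gaussianMeasure (hR : R.PosDef) (p : MvPolynomial (Fin d) ℝ)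
    (a : Fin d) :
    ∫ x, x a * eval x p ∂gaussianMeasure R =
      ∑ j, R a j * ∫ x, eval x (pderiv j p) ∂gaussianMeasure R := by
  have hp : X a * p = ∑ j, C (R a j) * (p * ∑ k, C (R⁻¹ j k) * X k) := by
    have h1 : ∀ k, ∑ j, R a j * R⁻¹ j k = if a = k then 1 else 0 := fun k => by
      rw [← mul_apply, mul_nonsing_inv _ ((isUnit_iff_isUnit_det R).1 hR.isUnit), one_apply]
    calc X a * p = p * ∑ k, C (∑ j, R a j * R⁻¹ j k) * X k := by
          simp [h1, mul_comm]
      _ = _ := by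
          simp only [map_sum, map_mul, Finset.mul_sum, Finset.sum_mul]
          rw [Finset.sum_comm]
          exact Finset.sum_congr rfl fun _ _ => Finset.sum_congr rfl fun _ _ => by ring
  have : ∀ x : Fin d → ℝ, x a * eval x p =
      ∑ j, R a j * eval x (p * ∑ k, C (R⁻¹ j k) * X k) := fun x => by
    simpa using congrArg (eval x) hp
  simp only [this]
  rw [integral_finsetSum _ fun j _ => (integrable_eval_gaussianMeasure hR _).const_mul _]
  simp only [integral_const_mul, integral_eval_gaussianMeasure,
    integral_eval_mul_gaussianPdf_by_parts hR]

end Gaussian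

lemma mem_pairingsOn {m : ℕ} {B : Finset (Fin m)} {σ : Equiv.Perm (Fin m)} :
    σ ∈ pairingsOn B ↔
      (∀ i, σ (σ i) = i) ∧ (∀ i ∈ B, σ i ≠ i ∧ σ i ∈ B) ∧ ∀ i ∉ B, σ i = i := by
  simp [pairingsOn]

lemma pairSum_empty {d m : ℕ} (C : Fin d → Fin d → ℝ) (α : Fin m → Fin d) :
    pairSum C α ∅ = 1 := by
  have : pairingsOn (∅ : Finset (Fin m)) = {1} := by
    ext σ
    simp only [mem_pairingsOn, Finset.mem_singleton, Equiv.ext_iff]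
    grind [Equiv.Perm.one_apply]
  simp [pairSum, this]

/-- Splitting the pairings of `B` according to the partner of the least position `a`. -/
lemma pairSum_eq_sum_erase_erase {d m : ℕ} (C : Fin d → Fin d → ℝ) (α : Fin m → Fin d)
    {B : Finset (Fin m)} {a : Fin m} (ha : a ∈ B) (hmin : ∀ b ∈ B, a ≤ b) :
    pairSum C α B =
      ∑ j ∈ B.erase a, C (α a) (α j) * pairSum C α ((B.erase a).erase j) := by
  simp only [pairSum, Finset.mul_sum]
  rw [Finset.sum_sigma']
  refine Finset.sum_bij' (fun σ _ => ⟨σ a, Equiv.swap a (σ a) * σ⟩)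
    (fun p _ => Equiv.swap a p.1 * p.2) ?_ ?_ ?_ ?_ ?_
  · intro σ hσ
    rw [mem_pairingsOn] at hσ
    simp only [Finset.mem_sigma, mem_pairingsOn, Equiv.Perm.mul_apply, Equiv.swap_apply_def,
      Finset.mem_erase]
    grind
  · rintro ⟨j, τ⟩ h
    simp only [Finset.mem_sigma, mem_pairingsOn, Finset.mem_erase] at h
    simp only [mem_pairingsOn, Equiv.Perm.mul_apply, Equiv.swap_apply_def]
    grind
  · intro σ hσ
    ext i
    simp
  · rintro ⟨j, τ⟩ h
    simp only [Finset.mem_sigma, mem_pairingsOn, Finset.mem_erase] at h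
    have hτ : τ a = a := h.2.2.2 a (by simp)
    simp [hτ]
  · intro σ hσ
    rw [mem_pairingsOn] at hσ
    obtain ⟨h1, h2, h3⟩ := hσ
    have ha' := h2 a ha
    have hτ : ∀ i ∈ (B.erase a).erase (σ a), (Equiv.swap a (σ a) * σ) i = σ i := fun i hi => by
      simp only [Finset.mem_erase] at hi
      simp only [Equiv.Perm.mul_apply, Equiv.swap_apply_def]
      grind
    have hfilter : B.filter (fun i => i < σ i) =
        insert a (((B.erase a).erase (σ a)).filter
          fun i => i < (Equiv.swap a (σ a) * σ) i) := by
      ext i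
      simp only [Finset.mem_filter, Finset.mem_insert, Finset.mem_erase]
      by_cases hi : i ∈ (B.erase a).erase (σ a)
      · rw [hτ i hi]
        simp only [Finset.mem_erase] at hi
        grind
      · simp only [Finset.mem_erase] at hi
        have := hmin (σ a) ha'.2
        grind
    rw [hfilter, Finset.prod_insert (by simp only [Finset.mem_filter, Finset.mem_erase]; tauto)]
    congr 1
    exact Finset.prod_congr rfl fun i hi => by rw [hτ i (Finset.mem_filter.1 hi).1]

lemma MvPolynomial.pderiv_prod {ι κ : Type*} [DecidableEq κ] (j : ι) (s : Finset κ)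
    (f : κ → MvPolynomial ι ℝ) :
    pderiv j (∏ i ∈ s, f i) = ∑ i ∈ s, pderiv j (f i) * ∏ k ∈ s.erase i, f k := by
  induction s using Finset.induction_on with
  | empty => simp
  | insert a s ha ih =>
    rw [Finset.prod_insert ha, pderiv_mul, ih, Finset.sum_insert ha, Finset.erase_insert ha,
      Finset.mul_sum]
    congr 1
    refine Finset.sum_congr rfl fun i hi => ?_
    have hia : a ≠ i := fun h => ha (h ▸ hi)
    rw [Finset.erase_insert_of_ne hia,
      Finset.prod_insert (fun h => ha (Finset.mem_of_mem_erase h))]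
    ring

/-- **Isserlis' theorem** for a centered Gaussian measure. -/
theorem integral_prod_gaussianMeasure {d m : ℕ} {R : Matrix (Fin d) (Fin d) ℝ} (hR : R.PosDef)
    [IsProbabilityMeasure (gaussianMeasure R)] (α : Fin m → Fin d) (B : Finset (Fin m)) :
    ∫ x, ∏ i ∈ B, x (α i) ∂gaussianMeasure R = pairSum R α B := by
  induction B using Finset.strongInduction with
  | H B ih =>
    rcases B.eq_empty_or_nonempty with rfl | hB
    · rw [pairSum_empty (fun i j => R i j)]
      simp
    set a := B.min' hB
    have ha : a ∈ B := B.min'_mem hB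
    have hprod : ∀ x : Fin d → ℝ, ∏ i ∈ B, x (α i) =
        x (α a) * MvPolynomial.eval x (∏ i ∈ B.erase a, MvPolynomial.X (α i)) := fun x => by
      simp [Finset.mul_prod_erase B (fun i => x (α i)) ha]
    have hF : ∀ i, Integrable (fun x => ∏ k ∈ (B.erase a).erase i, x (α k))
        (gaussianMeasure R) := fun i => by
      simpa [MvPolynomial.eval_prod] using integrable_eval_gaussianMeasure hR
        (∏ k ∈ (B.erase a).erase i, MvPolynomial.X (α k))
    have hderiv : ∀ j, ∫ x, MvPolynomial.eval x (MvPolynomial.pderiv j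
          (∏ i ∈ B.erase a, MvPolynomial.X (α i))) ∂gaussianMeasure R =
        ∑ i ∈ B.erase a, if α i = j then pairSum R α ((B.erase a).erase i) else 0 := fun j => by
      have : ∀ x : Fin d → ℝ, MvPolynomial.eval x (MvPolynomial.pderiv j
          (∏ i ∈ B.erase a, MvPolynomial.X (α i))) = ∑ i ∈ B.erase a,
            (if α i = j then 1 else 0) * ∏ k ∈ (B.erase a).erase i, x (α k) := fun x => by
        rw [MvPolynomial.pderiv_prod, map_sum]
        refine Finset.sum_congr rfl fun i _ => ?_
        rw [MvPolynomial.pderiv_X, Pi.single_apply]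
        split_ifs <;> simp
      simp only [this]
      rw [integral_finsetSum _ fun i _ => (hF i).const_mul _]
      refine Finset.sum_congr rfl fun i _ => ?_
      rw [integral_const_mul, ih _ ((Finset.erase_subset i _).trans_ssubset
        (Finset.erase_ssubset ha))]
      simp
    simp only [hprod]
    rw [integral_eval_X_mul_gaussianMeasure hR,
      pairSum_eq_sum_erase_erase R α ha fun b hb => B.min'_le b hb]
    simp only [hderiv, Finset.mul_sum]
    rw [Finset.sum_comm]
    simp

lemma integral_mul_gaussianMeasure {d : ℕ} {R : Matrix (Fin d) (Fin d) ℝ} (hR : R.PosDef)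
    [IsProbabilityMeasure (gaussianMeasure R)] (i j : Fin d) :
    ∫ x, x i * x j ∂gaussianMeasure R = R i j := by
  have := integral_eval_X_mul_gaussianMeasure hR (MvPolynomial.X j) i
  simpa [MvPolynomial.pderiv_X, Pi.single_apply, apply_ite (MvPolynomial.eval _)] using this

lemma ae_eq_one_or_eq_neg_one {Ω : Type*} [MeasurableSpace Ω] {P : Measure Ω}
    [IsProbabilityMeasure P] {ε : Ω → ℝ} (hεm : Measurable ε)
    (hε1 : P {ω | ε ω = 1} = 1 / 2) (hε2 : P {ω | ε ω = -1} = 1 / 2) :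
    ∀ᵐ ω ∂P, ε ω = 1 ∨ ε ω = -1 := by
  have h1 : MeasurableSet {ω | ε ω = 1} := hεm (measurableSet_singleton 1)
  have h2 : MeasurableSet {ω | ε ω = -1} := hεm (measurableSet_singleton (-1))
  have hd : Disjoint {ω | ε ω = 1} {ω | ε ω = -1} :=
    Set.disjoint_left.2 fun ω (h : ε ω = 1) (h' : ε ω = -1) => by linarith
  have h : P ({ω | ε ω = 1} ∪ {ω | ε ω = -1}) = 1 := by
    rw [measure_union hd h2, hε1, hε2, ENNReal.add_halves]
  exact mem_ae_iff_prob_eq_one (h1.union h2) |>.2 h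

lemma integral_pow_of_rademacher {Ω : Type*} [MeasurableSpace Ω] {P : Measure Ω}
    [IsProbabilityMeasure P] {ε : Ω → ℝ} (hεm : Measurable ε)
    (hε1 : P {ω | ε ω = 1} = 1 / 2) (hε2 : P {ω | ε ω = -1} = 1 / 2) (n : ℕ) :
    ∫ ω, ε ω ^ n ∂P = if Even n then 1 else 0 := by
  have h1 : MeasurableSet {ω | ε ω = 1} := hεm (measurableSet_singleton 1)
  have h2 : MeasurableSet {ω | ε ω = -1} := hεm (measurableSet_singleton (-1))
  have hae : (fun ω => ε ω ^ n) =ᵐ[P] fun ω => {ω | ε ω = 1}.indicator (fun _ => (1 : ℝ)) ω +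
      {ω | ε ω = -1}.indicator (fun _ => (-1 : ℝ) ^ n) ω := by
    filter_upwards [ae_eq_one_or_eq_neg_one hεm hε1 hε2] with ω hω
    rcases hω with h | h <;> simp [Set.indicator, h] <;> norm_num
  rw [integral_congr_ae hae, integral_add ((integrable_const _).indicator h1)
    ((integrable_const _).indicator h2), integral_indicator_const _ h1,
    integral_indicator_const _ h2, measureReal_def, measureReal_def, hε1, hε2]
  rcases Nat.even_or_odd n with h | h
  · simp [h, h.neg_one_pow]; norm_num
  · simp [h, h.neg_one_pow]

/-- **Isserlis theorem for a Bernoulli location mixture of a Gaussian vector (even case)**: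
if `X = εμ + ζ` with `ε` Rademacher, `ζ` centered Gaussian with covariance `R` independent
of `ε`, and `A = {α₁,…,α_{2N}}`, then
`E[X_A] = ∑_{k=0}^{N} ∑_{S⊆A, |S|=2k} μ_S ∑∏_{A∖S} E[ζ_i ζ_j]`. -/
theorem bernoulli_mixture_isserlis_even {d N : ℕ} {Ω : Type*} [MeasurableSpace Ω]
    (P : Measure Ω) [IsProbabilityMeasure P]
    (R : Matrix (Fin d) (Fin d) ℝ) (hR : R.PosDef)
    (ε : Ω → ℝ) (hεm : Measurable ε)
    (hε1 : P {ω | ε ω = 1} = 1/2) (hε2 : P {ω | ε ω = -1} = 1/2)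
    (ζ : Ω → Fin d → ℝ) (hζm : Measurable ζ)
    (hζ : Measure.map ζ P = gaussianMeasure R)
    (hind : IndepFun ε ζ P)
    (μ : Fin d → ℝ)
    (X : Ω → Fin d → ℝ) (hX : ∀ ω i, X ω i = ε ω * μ i + ζ ω i)
    (α : Fin (2 * N) → Fin d) :
    ∫ ω, ∏ i, X ω (α i) ∂P =
      ∑ k ∈ Finset.range (N + 1),
        ∑ S ∈ Finset.univ.powerset.filter (fun S : Finset (Fin (2 * N)) => S.card = 2 * k),
          (∏ i ∈ S, μ (α i)) *
            pairSum (fun i j => ∫ ω, ζ ω i * ζ ω j ∂P) α (Finset.univ \ S) := by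
  have hprob : IsProbabilityMeasure (gaussianMeasure R) :=
    hζ ▸ Measure.isProbabilityMeasure_map hζm.aemeasurable
  have hC : (fun i j => ∫ ω, ζ ω i * ζ ω j ∂P) = R := by
    ext i j
    rw [← integral_mul_gaussianMeasure hR i j, ← hζ, integral_map hζm.aemeasurable
      (by fun_prop)]
  have hF : ∀ B : Finset (Fin (2 * N)),
      Integrable (fun x => ∏ i ∈ B, x (α i)) (gaussianMeasure R) := fun B => by
    simpa [MvPolynomial.eval_prod] using
      integrable_eval_gaussianMeasure hR (∏ i ∈ B, MvPolynomial.X (α i))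
  have hmeas : ∀ B : Finset (Fin (2 * N)), Measurable fun x : Fin d → ℝ => ∏ i ∈ B, x (α i) :=
    fun B => by fun_prop
  have hζF : ∀ B : Finset (Fin (2 * N)), Integrable (fun ω => ∏ i ∈ B, ζ ω (α i)) P := fun B => by
    have := hF B
    rw [← hζ] at this
    exact this.comp_measurable hζm
  have hmoment : ∀ B : Finset (Fin (2 * N)),
      ∫ ω, ∏ i ∈ B, ζ ω (α i) ∂P = pairSum R α B := fun B => by
    rw [← integral_prod_gaussianMeasure hR, ← hζ, integral_map hζm.aemeasurable
      (hmeas B).aestronglyMeasurable]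
  have hεF : ∀ (n : ℕ) (B : Finset (Fin (2 * N))),
      Integrable (fun ω => ε ω ^ n * ∏ i ∈ B, ζ ω (α i)) P := fun n B => by
    refine (hζF B).bdd_mul (c := 1) (hεm.pow_const n).aestronglyMeasurable ?_
    filter_upwards [ae_eq_one_or_eq_neg_one hεm hε1 hε2] with ω hω
    rcases hω with h | h <;> simp [h]
  have hsplit : ∀ (n : ℕ) (B : Finset (Fin (2 * N))),
      ∫ ω, ε ω ^ n * ∏ i ∈ B, ζ ω (α i) ∂P = (if Even n then 1 else 0) * pairSum R α B :=
    fun n B => by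
      rw [← hmoment, ← integral_pow_of_rademacher hεm hε1 hε2 n]
      exact (hind.comp (measurable_id.pow_const n) (hmeas B)).integral_fun_mul_eq_mul_integral
        (hεm.pow_const n).aestronglyMeasurable (hζF B).aestronglyMeasurable
  have hexpand : ∀ ω, ∏ i, X ω (α i) = ∑ S ∈ Finset.univ.powerset, (∏ i ∈ S, μ (α i)) *
      (ε ω ^ S.card * ∏ i ∈ Finset.univ \ S, ζ ω (α i)) := fun ω => by
    simp only [hX, Finset.prod_add, Finset.prod_mul_distrib, Finset.prod_const]
    exact Finset.sum_congr rfl fun _ _ => by ring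
  simp only [hexpand, hC]
  rw [integral_finsetSum _ fun S _ => (hεF _ _).const_mul _]
  simp only [integral_const_mul, hsplit, Finset.sum_filter]
  rw [Finset.sum_comm]
  refine Finset.sum_congr rfl fun S _ => ?_
  split_ifs with h
  · obtain ⟨k, hk⟩ := h
    have hcard : S.card ≤ 2 * N := by simpa using Finset.card_le_univ S
    rw [Finset.sum_eq_single_of_mem k (Finset.mem_range.2 (by omega))
      (fun l _ hl => if_neg (by omega)), if_pos (by omega), one_mul]
  · rw [zero_mul, mul_zero]
    exact (Finset.sum_eq_zero fun k _ => if_neg fun hk => h ⟨k, by omega⟩).symm
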